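/- An identity e of type τ is a hyperconsequence of a set Σ of quasi-identities of type τ if and only if, for every hypersubstitution σ ∈ H(τ), there is a derivation of σ(e) from E ∪ Σ using only the substitution rule, the modus ponens rule, and the hypersubstitution rule, where E is the set of equality axioms of type τ. -/

import Mathlib

open scoped Classical

/-- Terms of a type `τ = (I, ar)`: an indexed family of operation symbols `I`
with arities `ar`, over countably many variables. -/
inductive Trm (I : Type) (ar : I → ℕ) : Type
  | var : ℕ → Trm I ar
  | app (f : I) : (Fin (ar f) → Trm I ar) → Trm I ar

variable {I : Type} {ar : I → ℕ}

/-- Simultaneous substitution of terms for variables. -/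
def Trm.subst (δ : ℕ → Trm I ar) : Trm I ar → Trm I ar
  | .var n => δ n
  | .app f ts => .app f fun i => (ts i).subst δ

/-- A hypersubstitution assigns to each operation symbol `f` a term `σ(f)`. -/
def Hyp (I : Type) (ar : I → ℕ) := (f : I) → Trm I ar

/-- The extension of a hypersubstitution to all terms. -/
def Hyp.apply (σ : Hyp I ar) : Trm I ar → Trm I ar
  | .var n => .var n
  | .app f ts => (σ f).subst fun n => if h : n < ar f then σ.apply (ts ⟨n, h⟩) else .var n

/-- The identity hypersubstitution `σ_id`. -/
def Hyp.id (I : Type) (ar : I → ℕ) : Hyp I ar := fun f => .app f fun i => .var i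

/-- Composition of hypersubstitutions: `(σ₁ ∘ σ₂)(f) = σ₁(σ₂(f))`. -/
def Hyp.comp (σ₁ σ₂ : Hyp I ar) : Hyp I ar := fun f => σ₁.apply (σ₂ f)

/-- Occurrence of the variable `m` in a term. -/
inductive Occurs (m : ℕ) : Trm I ar → Prop
  | var : Occurs m (.var m)
  | app {f ts} (i : Fin (ar f)) : Occurs m (ts i) → Occurs m (.app f ts)

/-- `σ` is a genuine hypersubstitution: `σ(f)` is an `(ar f)`-ary term,
i.e. its variables are among `x₀, …, x_{ar f - 1}`.  The set `{σ | IsHyp σ}`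
plays the role of the monoid `H(τ)` of all hypersubstitutions of type `τ`. -/
def IsHyp (σ : Hyp I ar) : Prop := ∀ f m, Occurs m (σ f) → m < ar f

/-- An identity `t ≈ s` of type `τ`. -/
abbrev Eqn (I : Type) (ar : I → ℕ) := Trm I ar × Trm I ar

/-- A quasi-identity `Δ → α` of type `τ`: a finite set `Δ` of identities
(the premises) together with an identity `α` (the conclusion). -/
abbrev Quasi (I : Type) (ar : I → ℕ) := Finset (Eqn I ar) × Eqn I ar

/-- Applying a map on terms to every term occurring in a quasi-identity. -/
noncomputable def mapQ (g : Trm I ar → Trm I ar) (q : Quasi I ar) : Quasi I ar :=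
  (q.1.image fun p => (g p.1, g p.2), (g q.2.1, g q.2.2))

/-- An algebra of type `τ`. -/
structure Alg (I : Type) (ar : I → ℕ) where
  carrier : Type
  ops : (f : I) → (Fin (ar f) → carrier) → carrier

/-- Evaluation of a term in an algebra under an assignment `v`. -/
def Alg.eval (A : Alg I ar) (v : ℕ → A.carrier) : Trm I ar → A.carrier
  | .var n => v n
  | .app f ts => A.ops f fun i => A.eval v (ts i)

/-- Satisfaction of a quasi-identity in an algebra: every assignment making all
premises hold makes the conclusion hold. -/
def Alg.Sat (A : Alg I ar) (q : Quasi I ar) : Prop :=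
  ∀ v : ℕ → A.carrier,
    (∀ p ∈ q.1, A.eval v p.1 = A.eval v p.2) → A.eval v q.2.1 = A.eval v q.2.2

/-- `M`-hypersatisfaction of a quasi-identity in an algebra: `A` satisfies
`σ(q)` for every hypersubstitution `σ ∈ M`. -/
def Alg.HypSatM (A : Alg I ar) (M : Set (Hyp I ar)) (q : Quasi I ar) : Prop :=
  ∀ σ ∈ M, A.Sat (mapQ (Hyp.apply σ) q)

/-- The quasi-equational calculus `Q` (when `M = ∅`), resp. its extension by the
hypersubstitution rule for the hypersubstitutions of `M`: `MHQ` for a submonoid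
`M ⊆ H(τ)`, and `HQ` when `M = {σ | IsHyp σ} = H(τ)`. -/
inductive Der (M : Set (Hyp I ar)) (S : Set (Quasi I ar)) : Quasi I ar → Prop
  | hyp {q} : q ∈ S → Der M S q
  | refl (p : Trm I ar) : Der M S (∅, (p, p))
  | assm (α : Eqn I ar) : Der M S ({α}, α)
  | symm (p q : Trm I ar) : Der M S ({(p, q)}, (q, p))
  | trans (p q r : Trm I ar) : Der M S ({(p, q), (q, r)}, (p, r))
  | compat (f : I) (t s : Fin (ar f) → Trm I ar) :
      Der M S (Finset.univ.image fun i => (t i, s i), (.app f t, .app f s))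
  | subst {q} (δ : ℕ → Trm I ar) : Der M S q → Der M S (mapQ (Trm.subst δ) q)
  | hypsub {q} {σ : Hyp I ar} : σ ∈ M → Der M S q → Der M S (mapQ (Hyp.apply σ) q)
  | cut {Δ Γ : Finset (Eqn I ar)} {α β : Eqn I ar} :
      Der M S (Δ, α) → Der M S (insert α Γ, β) → Der M S (Δ ∪ Γ, β)
  | ext {Δ : Finset (Eqn I ar)} {α : Eqn I ar} (β : Eqn I ar) :
      Der M S (Δ, α) → Der M S (insert β Δ, α)

/-- The set `E` of equality axioms of type `τ`: reflexivity, symmetry,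
transitivity and compatibility. -/
def Eax (I : Type) (ar : I → ℕ) : Set (Quasi I ar) :=
  {q | (∃ p : Trm I ar, q = (∅, (p, p))) ∨
    (∃ p r : Trm I ar, q = ({(p, r)}, (r, p))) ∨
    (∃ p r s : Trm I ar, q = ({(p, r), (r, s)}, (p, s))) ∨
    (∃ (f : I) (t s : Fin (ar f) → Trm I ar),
      q = (Finset.univ.image fun i => (t i, s i), (Trm.app f t, Trm.app f s)))}

/-- Derivations using only the substitution rule, the hypersubstitution rule
(for `σ ∈ M`) and the modus ponens rule. -/
inductive DerMP (M : Set (Hyp I ar)) (S : Set (Quasi I ar)) : Quasi I ar → Prop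
  | hyp {q} : q ∈ S → DerMP M S q
  | subst {q} (δ : ℕ → Trm I ar) : DerMP M S q → DerMP M S (mapQ (Trm.subst δ) q)
  | hypsub {q} {σ : Hyp I ar} : σ ∈ M → DerMP M S q → DerMP M S (mapQ (Hyp.apply σ) q)
  | mp {Δ : Finset (Eqn I ar)} {α β : Eqn I ar} :
      DerMP M S (∅, α) → DerMP M S (insert α Δ, β) → DerMP M S (Δ, β)

theorem Trm.subst_congr {δ ε : ℕ → Trm I ar} (t : Trm I ar)
    (h : ∀ n, Occurs n t → δ n = ε n) : t.subst δ = t.subst ε := by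
  induction t with
  | var n => exact h n .var
  | app f ts ih =>
    simp only [Trm.subst]
    congr 1
    funext i
    exact ih i fun n hn => h n (.app i hn)

theorem Trm.subst_subst (δ ε : ℕ → Trm I ar) (t : Trm I ar) :
    (t.subst δ).subst ε = t.subst fun n => (δ n).subst ε := by
  induction t with
  | var n => rfl
  | app f ts ih =>
    simp only [Trm.subst]
    congr 1
    funext i
    exact ih i

theorem Occurs.exists_of_subst {δ : ℕ → Trm I ar} {m : ℕ} (t : Trm I ar)
    (h : Occurs m (t.subst δ)) : ∃ n, Occurs n t ∧ Occurs m (δ n) := by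
  induction t with
  | var n => exact ⟨n, .var, h⟩
  | app f ts ih =>
    simp only [Trm.subst] at h
    cases h with
    | app i hi =>
      obtain ⟨n, hn, hm⟩ := ih i hi
      exact ⟨n, .app i hn, hm⟩

theorem Occurs.of_apply {σ : Hyp I ar} (hσ : IsHyp σ) {m : ℕ} (t : Trm I ar)
    (h : Occurs m (σ.apply t)) : Occurs m t := by
  induction t with
  | var n => exact h
  | app f ts ih =>
    obtain ⟨n, hn, hm⟩ := Occurs.exists_of_subst _ h
    rw [dif_pos (hσ f n hn)] at hm
    exact .app _ (ih _ hm)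

theorem IsHyp.comp {σ ρ : Hyp I ar} (hσ : IsHyp σ) (hρ : IsHyp ρ) : IsHyp (σ.comp ρ) :=
  fun f m h => hρ f m (Occurs.of_apply hσ _ h)

theorem Hyp.apply_subst {σ : Hyp I ar} (hσ : IsHyp σ) (δ : ℕ → Trm I ar) (t : Trm I ar) :
    σ.apply (t.subst δ) = (σ.apply t).subst fun n => σ.apply (δ n) := by
  induction t with
  | var n => rfl
  | app f ts ih =>
    simp only [Trm.subst, Hyp.apply, Trm.subst_subst]
    refine Trm.subst_congr _ fun n hn => ?_
    simp only [dif_pos (hσ f n hn), ih]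

theorem Hyp.comp_apply {σ : Hyp I ar} (hσ : IsHyp σ) (ρ : Hyp I ar) (t : Trm I ar) :
    (σ.comp ρ).apply t = σ.apply (ρ.apply t) := by
  induction t with
  | var n => rfl
  | app f ts ih =>
    simp only [Hyp.apply, Hyp.apply_subst hσ, Hyp.comp]
    refine Trm.subst_congr _ fun n _ => ?_
    split_ifs
    · exact ih _
    · rfl

theorem Hyp.isHyp_id : IsHyp (Hyp.id I ar) := by
  intro f m h
  cases h with
  | app i hi =>
    cases hi
    exact i.2

theorem Hyp.id_apply (t : Trm I ar) : (Hyp.id I ar).apply t = t := by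
  induction t with
  | var n => rfl
  | app f ts ih =>
    simp only [Hyp.apply, Hyp.id, Trm.subst, Fin.is_lt, dite_true, Fin.eta, ih]

theorem Alg.eval_subst (A : Alg I ar) (v : ℕ → A.carrier) (δ : ℕ → Trm I ar) (t : Trm I ar) :
    A.eval v (t.subst δ) = A.eval (fun n => A.eval v (δ n)) t := by
  induction t with
  | var n => rfl
  | app f ts ih => simp only [Trm.subst, Alg.eval, ih]

theorem Alg.sat_mapQ (A : Alg I ar) (g : Trm I ar → Trm I ar) (q : Quasi I ar) :
    A.Sat (mapQ g q) ↔ ∀ v : ℕ → A.carrier,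
      (∀ p ∈ q.1, A.eval v (g p.1) = A.eval v (g p.2)) →
        A.eval v (g q.2.1) = A.eval v (g q.2.2) := by
  simp only [Alg.Sat, mapQ, Finset.forall_mem_image]

theorem Alg.hypSatM_of_mem_eax (A : Alg I ar) (M : Set (Hyp I ar)) {q : Quasi I ar}
    (hq : q ∈ Eax I ar) : A.HypSatM M q := by
  intro σ _
  rw [Alg.sat_mapQ]
  intro v h
  rcases hq with ⟨p, rfl⟩ | ⟨p, r, rfl⟩ | ⟨p, r, s, rfl⟩ | ⟨f, t, s, rfl⟩
  · rfl
  · exact (h (p, r) (by simp)).symm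
  · exact (h (p, r) (by simp)).trans (h (r, s) (by simp))
  · simp only [Hyp.apply, Alg.eval_subst]
    congr 1
    funext n
    split_ifs with hn
    · exact h (t ⟨n, hn⟩, s ⟨n, hn⟩) (Finset.mem_image_of_mem _ (Finset.mem_univ _))
    · rfl

/-- The calculus is sound for hypersatisfaction. -/
theorem DerMP.hypSatM {S : Set (Quasi I ar)} {A : Alg I ar}
    (hA : ∀ q ∈ S, A.HypSatM {σ : Hyp I ar | IsHyp σ} q) {q : Quasi I ar}
    (h : DerMP {σ : Hyp I ar | IsHyp σ} (Eax I ar ∪ S) q) :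
    A.HypSatM {σ : Hyp I ar | IsHyp σ} q := by
  induction h with
  | hyp hq => exact hq.elim (A.hypSatM_of_mem_eax _) (hA _)
  | @subst q δ _ ih =>
    intro σ hσ
    have hs := (A.sat_mapQ _ _).1 (ih σ hσ)
    rw [Alg.sat_mapQ]
    intro v hv
    simp only [mapQ, Finset.forall_mem_image, Hyp.apply_subst hσ, Alg.eval_subst] at hv ⊢
    exact hs _ hv
  | @hypsub q ρ hρ _ ih =>
    intro σ hσ
    have hs := (A.sat_mapQ _ _).1 (ih (σ.comp ρ) (IsHyp.comp hσ hρ))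
    rw [Alg.sat_mapQ]
    intro v hv
    simp only [Hyp.comp_apply hσ] at hs
    simp only [mapQ, Finset.forall_mem_image] at hv ⊢
    exact hs v hv
  | @mp Δ α β _ _ ih₁ ih₂ =>
    intro σ hσ
    have h₁ := (A.sat_mapQ _ _).1 (ih₁ σ hσ)
    have h₂ := (A.sat_mapQ _ _).1 (ih₂ σ hσ)
    rw [Alg.sat_mapQ]
    intro v hv
    refine h₂ v fun p hp => ?_
    rcases Finset.mem_insert.1 hp with rfl | hp
    · exact h₁ v (by simp)
    · exact hv p hp

theorem DerMP.of_premises {M : Set (Hyp I ar)} {S : Set (Quasi I ar)} {Δ : Finset (Eqn I ar)}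
    {β : Eqn I ar} (h : DerMP M S (Δ, β)) (hΔ : ∀ p ∈ Δ, DerMP M S (∅, p)) :
    DerMP M S (∅, β) := by
  induction Δ using Finset.induction_on with
  | empty => exact h
  | insert a Δ _ ih =>
    exact ih (.mp (hΔ a (Finset.mem_insert_self _ _)) h)
      fun p hp => hΔ p (Finset.mem_insert_of_mem hp)

/-- Derivable equality of terms. -/
def derSetoid (M : Set (Hyp I ar)) (S : Set (Quasi I ar)) : Setoid (Trm I ar) where
  r t s := DerMP M (Eax I ar ∪ S) (∅, (t, s))
  iseqv :=
    { refl := fun p => .hyp (.inl (.inl ⟨p, rfl⟩))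
      symm := fun {p r} h =>
        DerMP.of_premises (.hyp (.inl (.inr (.inl ⟨p, r, rfl⟩)))) (by simpa using h)
      trans := fun {p r s} h₁ h₂ =>
        DerMP.of_premises (.hyp (.inl (.inr (.inr (.inl ⟨p, r, s, rfl⟩)))))
          (by
            intro x hx
            rcases Finset.mem_insert.1 hx with rfl | hx
            · exact h₁
            · rw [Finset.mem_singleton.1 hx]
              exact h₂) }

theorem derSetoid_app {M : Set (Hyp I ar)} {S : Set (Quasi I ar)} (f : I)
    {t s : Fin (ar f) → Trm I ar} (h : ∀ i, derSetoid M S (t i) (s i)) :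
    derSetoid M S (.app f t) (.app f s) :=
  DerMP.of_premises (.hyp (.inl (.inr (.inr (.inr ⟨f, t, s, rfl⟩)))))
    (by
      rw [Finset.forall_mem_image]
      exact fun i _ => h i)

/-- The term algebra modulo derivable equality. -/
noncomputable def derAlg (M : Set (Hyp I ar)) (S : Set (Quasi I ar)) : Alg I ar where
  carrier := Quotient (derSetoid M S)
  ops f x := Quotient.mk _ (.app f fun i => (x i).out)

theorem derAlg_eval {M : Set (Hyp I ar)} {S : Set (Quasi I ar)} (δ : ℕ → Trm I ar)
    (t : Trm I ar) :
    (derAlg M S).eval (fun n => Quotient.mk (derSetoid M S) (δ n)) t =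
      Quotient.mk (derSetoid M S) (t.subst δ) := by
  induction t with
  | var n => rfl
  | app f ts ih =>
    simp only [Alg.eval, ih]
    exact Quotient.sound (derSetoid_app f fun i => Quotient.mk_out _)

theorem derAlg_sat {M : Set (Hyp I ar)} {S : Set (Quasi I ar)} {q : Quasi I ar}
    (hq : DerMP M (Eax I ar ∪ S) q) : (derAlg M S).Sat q := by
  intro v hv
  obtain ⟨δ, rfl⟩ : ∃ δ : ℕ → Trm I ar, (fun n => Quotient.mk (derSetoid M S) (δ n)) = v :=
    ⟨fun n => (v n).out, funext fun n => Quotient.out_eq _⟩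
  simp only [derAlg_eval] at hv ⊢
  refine Quotient.sound (DerMP.of_premises (hq.subst δ) ?_)
  rw [Finset.forall_mem_image]
  exact fun p hp => Quotient.exact (hv p hp)

theorem Trm.subst_var (t : Trm I ar) : t.subst .var = t := by
  induction t with
  | var n => rfl
  | app f ts ih => simp only [Trm.subst, ih]

/-- An identity `e` is a hyperconsequence of a set `Σ` of quasi-identities if
and only if, for every hypersubstitution `σ ∈ H(τ)`, there is a derivation of
`σ(e)` from `E ∪ Σ` using only the substitution rule, the modus ponens rule and
the hypersubstitution rule. -/
theorem identity_hyperconsequence_iff (S : Set (Quasi I ar)) (α : Eqn I ar) :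
    (∀ A : Alg I ar, (∀ q ∈ S, A.HypSatM {σ : Hyp I ar | IsHyp σ} q) →
        A.HypSatM {σ : Hyp I ar | IsHyp σ} (∅, α)) ↔
      ∀ σ : Hyp I ar, IsHyp σ →
        DerMP {σ' : Hyp I ar | IsHyp σ'} (Eax I ar ∪ S) (mapQ (Hyp.apply σ) (∅, α)) := by
  constructor
  · intro h σ hσ
    have hs := (Alg.sat_mapQ _ _ _).1 (h (derAlg {σ' : Hyp I ar | IsHyp σ'} S)
      (fun q hq ρ hρ => derAlg_sat (.hypsub hρ (.hyp (.inr hq)))) σ hσ)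
      (fun n => Quotient.mk _ (.var n)) (by simp)
    simp only [derAlg_eval, Trm.subst_var] at hs
    exact Quotient.exact hs
  · intro h A hA σ hσ
    have hs := (A.sat_mapQ _ _).1 ((h σ hσ).hypSatM hA (Hyp.id I ar) Hyp.isHyp_id)
    simp only [Hyp.id_apply] at hs
    exact hs
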